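/- arXiv:2504.19582 — 2 statements merged into one kernel-verified Lean document; each statement's English description precedes it below -/
import Mathlib

section
/- Let n > t ≥ 2 be integers. If a finite simple K_{t+2}-minor-free graph U contains every n-vertex graph of pathwidth at most t as a subgraph, then U has at least 2^{(n−t−4)/t} vertices. -/
open SimpleGraph

/-- `H` is a minor of `G`: there are pairwise disjoint, connected (hence nonempty) branch
sets, one for each vertex of `H`, with an edge of `G` between the branch sets of any two
adjacent vertices of `H`. -/
def SimpleGraph.HasMinor {α : Type*} {β : Type*} (G : SimpleGraph α) (H : SimpleGraph β) : Prop :=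
  ∃ B : β → Set α,
    (∀ b, (SimpleGraph.induce (B b) G).Connected) ∧
    (Pairwise fun b b' => Disjoint (B b) (B b')) ∧
    (∀ b b', H.Adj b b' → ∃ u ∈ B b, ∃ v ∈ B b', G.Adj u v)
/-- `G` has a path-decomposition of width at most `k`. -/
def HasPathwidthAtMost {V : Type*} (G : SimpleGraph V) (k : ℕ) : Prop :=
  ∃ (m : ℕ) (B : Fin (m + 1) → Set V),
    (∀ v, ∃ i, v ∈ B i) ∧
    (∀ u v, G.Adj u v → ∃ i, u ∈ B i ∧ v ∈ B i) ∧
    (∀ v, ∀ i j l : Fin (m + 1), i ≤ j → j ≤ l → v ∈ B i → v ∈ B l → v ∈ B j) ∧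
    (∀ i, (B i).ncard ≤ k + 1)
/-- `U` contains `H` as a subgraph. -/
def ContainsSub {α β : Type*} (U : SimpleGraph β) (H : SimpleGraph α) : Prop :=
  ∃ f : α → β, Function.Injective f ∧ ∀ a b, H.Adj a b → U.Adj (f a) (f b)

/-- `ReachAvoiding U T u v`: some walk of `U` from `u` to `v` meets `T` at most in `u`. -/
def ReachAvoiding {V : Type*} (U : SimpleGraph V) (T : Set V) : V → V → Prop :=
  Relation.ReflTransGen fun a b => U.Adj a b ∧ b ∉ T

namespace ReachAvoiding

variable {V : Type*} {U : SimpleGraph V} {S T : Set V} {u v w : V}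

theorem mono (h : S ⊆ T) (huv : ReachAvoiding U T u v) : ReachAvoiding U S u v :=
  Relation.ReflTransGen.mono (fun _ _ hab => ⟨hab.1, fun hb => hab.2 (h hb)⟩) _ _ huv

theorem step (huv : ReachAvoiding U T u v) (hvw : U.Adj v w) (hw : w ∉ T) :
    ReachAvoiding U T u w :=
  Relation.ReflTransGen.tail huv ⟨hvw, hw⟩

theorem notMem (hu : u ∉ T) (huv : ReachAvoiding U T u v) : v ∉ T := by
  cases huv with
  | refl => exact hu
  | tail _ h => exact h.2

/-- A walk avoiding `S` that ends in `R` has an edge entering `R` for the first time. -/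
theorem exists_adj_of_mem {R : Set V} (hu : u ∉ R) (huv : ReachAvoiding U S u v) (hv : v ∈ R) :
    ∃ a, ReachAvoiding U (S ∪ R) u a ∧ ∃ b ∈ R, U.Adj a b := by
  have key : ∀ z, ReachAvoiding U S u z → ReachAvoiding U (S ∪ R) u z ∨
      ∃ a, ReachAvoiding U (S ∪ R) u a ∧ ∃ b ∈ R, U.Adj a b := by
    intro z hz
    induction hz with
    | refl => exact .inl .refl
    | @tail b c _ hbc ih =>
      rcases ih with ih | ih
      · by_cases hc : c ∈ R
        · exact .inr ⟨b, ih, c, hc, hbc.1⟩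
        · exact .inl (ih.step hbc.1 (by simp [hbc.2, hc]))
      · exact .inr ih
  rcases key v huv with h | h
  · have huR : ReachAvoiding U R u v := h.mono Set.subset_union_right
    exact absurd hv (huR.notMem hu)
  · exact h

end ReachAvoiding

theorem SimpleGraph.induce_connected_of_reflTransGen {V : Type*} {U : SimpleGraph V} {K : Set V}
    {x : V} (hx : x ∈ K)
    (h : ∀ v ∈ K, Relation.ReflTransGen (fun a b => U.Adj a b ∧ b ∈ K) x v) :
    (U.induce K).Connected := by
  have key : ∀ v, Relation.ReflTransGen (fun a b => U.Adj a b ∧ b ∈ K) x v →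
      ∃ hv : v ∈ K, (U.induce K).Reachable ⟨x, hx⟩ ⟨v, hv⟩ := by
    intro v hv
    induction hv with
    | refl => exact ⟨hx, .refl _⟩
    | @tail b c _ hbc ih =>
      obtain ⟨hb, hr⟩ := ih
      refine ⟨hbc.2, hr.trans (SimpleGraph.Adj.reachable ?_)⟩
      simpa using hbc.1
  rw [SimpleGraph.connected_iff_exists_forall_reachable]
  exact ⟨⟨x, hx⟩, fun ⟨v, hv⟩ => (key v (h v hv)).2⟩

theorem SimpleGraph.induce_connected_reachAvoiding {V : Type*} (U : SimpleGraph V) (T : Set V)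
    (x : V) : (U.induce {v | ReachAvoiding U T x v}).Connected := by
  refine induce_connected_of_reflTransGen (x := x) Relation.ReflTransGen.refl ?_
  intro v hv
  induction hv with
  | refl => exact .refl
  | tail hb hbc ih => exact ih.tail ⟨hbc.1, ReachAvoiding.step hb hbc.1 hbc.2⟩

/-- A `t`-clique together with two adjacent connected sets seeing all of it is a `K_{t+2}`
minor. -/
theorem SimpleGraph.hasMinor_top_of_clique {V : Type*} {U : SimpleGraph V} {t : ℕ}
    {q : Fin t → V} (hq : Pairwise fun c d => U.Adj (q c) (q d)) {K R : Set V}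
    (hK : (U.induce K).Connected) (hR : (U.induce R).Connected) (hKR : Disjoint K R)
    (hqK : ∀ c, q c ∉ K) (hqR : ∀ c, q c ∉ R)
    (hadjK : ∀ c, ∃ w ∈ K, U.Adj w (q c)) (hadjR : ∀ c, ∃ w ∈ R, U.Adj w (q c))
    (hadj : ∃ a ∈ K, ∃ b ∈ R, U.Adj a b) :
    U.HasMinor (⊤ : SimpleGraph (Fin (t + 2))) := by
  refine ⟨Fin.cons K (Fin.cons R fun c => {q c}), ?_, ?_, ?_⟩
  · intro b
    refine Fin.cases hK (fun b => ?_) b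
    refine Fin.cases hR (fun c => ?_) b
    change (U.induce {q c}).Connected
    exact induce_connected_of_reflTransGen (x := q c) rfl (by rintro v rfl; exact .refl)
  · intro a b
    refine Fin.cases ?_ (fun a => Fin.cases ?_ (fun a => ?_) a) a <;>
    refine Fin.cases ?_ (fun b => Fin.cases ?_ (fun b => ?_) b) b <;>
    intro hab <;> simp only [Fin.cons_succ, Fin.cons_zero]
    · exact absurd rfl hab
    · exact hKR
    · simpa using hqK b
    · exact hKR.symm
    · exact absurd rfl hab
    · simpa using hqR b
    · simpa using hqK a
    · simpa using hqR a
    · have : a ≠ b := fun h => hab (by rw [h])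
      simpa using (hq this).ne
  · intro a b
    obtain ⟨u, hu, v, hv, huv⟩ := hadj
    refine Fin.cases ?_ (fun a => Fin.cases ?_ (fun a => ?_) a) a <;>
    refine Fin.cases ?_ (fun b => Fin.cases ?_ (fun b => ?_) b) b <;>
    intro hab <;> simp only [Fin.cons_succ, Fin.cons_zero]
    · exact absurd rfl hab
    · exact ⟨u, hu, v, hv, huv⟩
    · obtain ⟨w, hw, h⟩ := hadjK b
      exact ⟨w, hw, _, rfl, h⟩
    · exact ⟨v, hv, u, hu, huv.symm⟩
    · exact absurd rfl hab
    · obtain ⟨w, hw, h⟩ := hadjR b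
      exact ⟨w, hw, _, rfl, h⟩
    · obtain ⟨w, hw, h⟩ := hadjK a
      exact ⟨_, rfl, w, hw, h.symm⟩
    · obtain ⟨w, hw, h⟩ := hadjR a
      exact ⟨_, rfl, w, hw, h.symm⟩
    · have : a ≠ b := fun h => hab (by rw [h])
      exact ⟨_, rfl, _, rfl, hq this⟩

/-- The `i`-th separator of the `t`-path with replacement sequence `s`: vertex `t + 1 + i` is
joined to `stripSep s i`, and then takes the place of the entry with index `s i`. -/
def stripSep {t : ℕ} (s : ℕ → Fin t) : ℕ → Fin t → ℕ
  | 0 => fun c => c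
  | i + 1 => Function.update (stripSep s i) (s i) (t + 1 + i)

section stripSep

variable {t : ℕ} (s : ℕ → Fin t)

theorem stripSep_succ_self (i : ℕ) : stripSep s (i + 1) (s i) = t + 1 + i := by
  simp [stripSep]

theorem stripSep_succ_of_ne {i : ℕ} {c : Fin t} (h : c ≠ s i) :
    stripSep s (i + 1) c = stripSep s i c := by
  simp [stripSep, h]

theorem stripSep_lt (i : ℕ) (c : Fin t) : stripSep s i c < t + 1 + i := by
  induction i with
  | zero => simp only [stripSep]; omega
  | succ i ih =>
    by_cases h : c = s i
    · subst h; rw [stripSep_succ_self]; omega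
    · rw [stripSep_succ_of_ne s h]; omega

theorem stripSep_ne (i : ℕ) (c : Fin t) : stripSep s i c ≠ t := by
  induction i with
  | zero => simp only [stripSep]; omega
  | succ i ih =>
    by_cases h : c = s i
    · subst h; rw [stripSep_succ_self]; omega
    · rwa [stripSep_succ_of_ne s h]

theorem stripSep_injective (i : ℕ) : Function.Injective (stripSep s i) := by
  induction i with
  | zero => exact Fin.val_injective
  | succ i ih =>
    intro c d hcd
    have hc := stripSep_lt s i c
    have hd := stripSep_lt s i d
    by_cases h : c = s i <;> by_cases h' : d = s i
    · rw [h, h']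
    · rw [h, stripSep_succ_self, stripSep_succ_of_ne s h'] at hcd; omega
    · rw [h', stripSep_succ_self, stripSep_succ_of_ne s h] at hcd; omega
    · rw [stripSep_succ_of_ne s h, stripSep_succ_of_ne s h'] at hcd
      exact ih hcd

theorem mem_range_stripSep_of_le {j l u : ℕ} (hjl : j ≤ l) (hu : u < t + 1 + j)
    (h : u ∈ Set.range (stripSep s l)) : u ∈ Set.range (stripSep s j) := by
  induction l, hjl using Nat.le_induction with
  | base => exact h
  | succ l hl ih =>
    obtain ⟨c, rfl⟩ := h
    by_cases hc : c = s l
    · subst hc; rw [stripSep_succ_self] at hu; omega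
    · exact ih ⟨c, (stripSep_succ_of_ne s hc).symm⟩

/-- The bags of the `t`-path with replacement sequence `s`. -/
def stripBag (j : ℕ) : Set ℕ :=
  insert (t + j) (Set.range (stripSep s (j - 1)))

theorem stripBag_interval {i j l v : ℕ} (hij : i ≤ j) (hjl : j ≤ l) (hi : v ∈ stripBag s i)
    (hl : v ∈ stripBag s l) : v ∈ stripBag s j := by
  rcases hij.eq_or_lt with rfl | hij
  · exact hi
  have hvi : v ≤ t + i := by
    rcases hi with rfl | ⟨c, rfl⟩
    · exact le_rfl
    · have h1 := stripSep_lt s (i - 1) c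
      have h2 := stripSep_ne s (i - 1) c
      cases i with
      | zero => change (c : ℕ) ≤ t + 0; omega
      | succ i => rw [Nat.add_sub_cancel] at h1 ⊢; omega
  rcases hl with rfl | hl
  · omega
  · exact .inr (mem_range_stripSep_of_le s (by omega) (by omega) hl)

/-- The `t`-path on `n` vertices with replacement sequence `s`. -/
def stripGraph (n : ℕ) : SimpleGraph (Fin n) where
  Adj a b := a ≠ b ∧ ∃ j < n - t, (a : ℕ) ∈ stripBag s j ∧ (b : ℕ) ∈ stripBag s j
  symm := ⟨fun _ _ h => ⟨h.1.symm, h.2.imp fun _ h => ⟨h.1, h.2.2, h.2.1⟩⟩⟩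
  loopless := ⟨fun _ h => h.1 rfl⟩

theorem stripGraph_hasPathwidthAtMost {n : ℕ} (hn : t < n) :
    HasPathwidthAtMost (stripGraph s n) t := by
  refine ⟨n - t - 1, fun i => {a | (a : ℕ) ∈ stripBag s i}, ?_, ?_, ?_, ?_⟩
  · intro v
    by_cases hv : (v : ℕ) < t
    · exact ⟨0, .inr ⟨⟨v, hv⟩, rfl⟩⟩
    · exact ⟨⟨v - t, by omega⟩, .inl (show (v : ℕ) = t + (v - t) by omega)⟩
  · rintro u v ⟨-, j, hj, h⟩
    exact ⟨⟨j, by omega⟩, h⟩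
  · intro v i j l hij hjl hi hl
    exact stripBag_interval s hij hjl hi hl
  · intro i
    have hfin : (Set.range (stripSep s (i - 1))).Finite := Set.finite_range _
    calc Set.ncard {a : Fin n | (a : ℕ) ∈ stripBag s i}
        = Set.ncard (Fin.val '' {a : Fin n | (a : ℕ) ∈ stripBag s i}) :=
          (Set.ncard_image_of_injective _ Fin.val_injective).symm
      _ ≤ Set.ncard (stripBag s i) :=
          Set.ncard_le_ncard (by rintro _ ⟨a, ha, rfl⟩; exact ha) (hfin.insert _)
      _ ≤ Set.ncard (Set.range (stripSep s (i - 1))) + 1 := Set.ncard_insert_le _ _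
      _ = t + 1 := by
          rw [← Set.image_univ, Set.ncard_image_of_injective _ (stripSep_injective s _),
            Set.ncard_univ, Nat.card_fin]

end stripSep

/-- `f` embeds the `t`-path on `t + k + 2` vertices with replacement sequence `s` into `U`. -/
structure IsStripEmbedding {V : Type*} (U : SimpleGraph V) {t : ℕ} (k : ℕ) (s : ℕ → Fin t)
    (f : ℕ → V) : Prop where
  inj : ∀ a b, a < t + k + 2 → b < t + k + 2 → f a = f b → a = b
  adj_init : ∀ c : Fin t, U.Adj (f t) (f c)
  clique_init : ∀ c d : Fin t, c ≠ d → U.Adj (f c) (f d)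
  adj : ∀ i ≤ k, ∀ c, U.Adj (f (stripSep s i c)) (f (t + 1 + i))

theorem ContainsSub.exists_isStripEmbedding {V : Type*} {U : SimpleGraph V} {t k : ℕ}
    {s : ℕ → Fin t} (h : ContainsSub U (stripGraph s (t + k + 2))) :
    ∃ f, IsStripEmbedding U k s f := by
  obtain ⟨f, hf, hadj⟩ := h
  have key : ∀ a b (ha : a < t + k + 2) (hb : b < t + k + 2) j, a ≠ b → j < k + 2 →
      a ∈ stripBag s j → b ∈ stripBag s j → U.Adj (f ⟨a, ha⟩) (f ⟨b, hb⟩) :=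
    fun a b ha hb j hab hj hja hjb =>
      hadj _ _ ⟨by simpa using hab, j, by omega, hja, hjb⟩
  refine ⟨fun a => if h : a < t + k + 2 then f ⟨a, h⟩ else f ⟨0, by omega⟩, ?_, ?_, ?_, ?_⟩
  · intro a b ha hb hab
    simp only [ha, hb, dif_pos] at hab
    exact congrArg Fin.val (hf hab)
  · intro c
    have hc : (c : ℕ) < t + k + 2 := by omega
    have ht : t < t + k + 2 := by omega
    simp only [hc, ht, dif_pos]
    exact key _ _ _ _ 0 (by omega) (by omega) (.inl rfl) (.inr ⟨c, rfl⟩)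
  · intro c d hcd
    have hc : (c : ℕ) < t + k + 2 := by omega
    have hd : (d : ℕ) < t + k + 2 := by omega
    simp only [hc, hd, dif_pos]
    exact key _ _ _ _ 0 (by omega) (by omega) (.inr ⟨c, rfl⟩) (.inr ⟨d, rfl⟩)
  · intro i hi c
    have hlt := stripSep_lt s i c
    have hc : stripSep s i c < t + k + 2 := by omega
    have hd : t + 1 + i < t + k + 2 := by omega
    simp only [hc, hd, dif_pos]
    exact key _ _ _ _ (i + 1) (by omega) (by omega) (.inr ⟨c, rfl⟩)
      (.inl (by omega))

namespace IsStripEmbedding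

variable {V : Type*} {U : SimpleGraph V} {t k : ℕ} {s s' : ℕ → Fin t} {f g : ℕ → V}

theorem notMem_range (hf : IsStripEmbedding U k s f) {i j : ℕ} (hij : i ≤ j) (hj : j ≤ k) :
    f (t + 1 + j) ∉ Set.range (f ∘ stripSep s i) := by
  rintro ⟨c, hc⟩
  have h := stripSep_lt s i c
  have := hf.inj _ _ (by omega) (by omega) hc
  omega

theorem injective (hf : IsStripEmbedding U k s f) {i : ℕ} (hi : i ≤ k) :
    Function.Injective (f ∘ stripSep s i) := by
  intro c d hcd
  have hc := stripSep_lt s i c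
  have hd := stripSep_lt s i d
  exact stripSep_injective s i (hf.inj _ _ (by omega) (by omega) hcd)

theorem range_succ_subset (i : ℕ) :
    Set.range (f ∘ stripSep s (i + 1)) ⊆
      insert (f (t + 1 + i)) (Set.range (f ∘ stripSep s i)) := by
  rintro _ ⟨c, rfl⟩
  by_cases h : c = s i
  · subst h; left; simp [stripSep_succ_self]
  · right; exact ⟨c, by simp [stripSep_succ_of_ne s h]⟩

/-- The replaced vertex is not in the next separator. -/
theorem replaced_notMem (hf : IsStripEmbedding U k s f) {i : ℕ} (hi : i < k) :
    f (stripSep s i (s i)) ∉ Set.range (f ∘ stripSep s (i + 1)) := by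
  rintro ⟨c, hc⟩
  have h1 := stripSep_lt s i (s i)
  have h2 := stripSep_lt s (i + 1) c
  have h := hf.inj _ _ (by omega) (by omega) hc
  by_cases hcs : c = s i
  · subst hcs; rw [stripSep_succ_self] at h; omega
  · rw [stripSep_succ_of_ne s hcs] at h
    exact hcs (stripSep_injective s i h)

theorem adj_succ (hf : IsStripEmbedding U k s f) {j : ℕ} (hj : j < k) :
    U.Adj (f (t + 1 + j)) (f (t + 1 + (j + 1))) := by
  simpa [stripSep_succ_self] using hf.adj (j + 1) hj (s j)

theorem reach_last (hf : IsStripEmbedding U k s f) {T : Set V} {j : ℕ} (hj : j ≤ k)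
    (hT : ∀ l, j ≤ l → l ≤ k → f (t + 1 + l) ∉ T) {x : V}
    (hx : ReachAvoiding U T x (f (t + 1 + j))) : ReachAvoiding U T x (f (t + 1 + k)) := by
  have key : ∀ l, j ≤ l → l ≤ k → ReachAvoiding U T x (f (t + 1 + l)) := by
    intro l hl
    induction l, hl using Nat.le_induction with
    | base => exact fun _ => hx
    | succ l hl ih =>
      intro hlk
      exact (ih (by omega)).step (hf.adj_succ hlk) (hT _ (by omega) hlk)
  exact key k hj le_rfl

theorem clique (hf : IsStripEmbedding U k s f) {i : ℕ} (hi : i ≤ k) :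
    Pairwise fun c d => U.Adj (f (stripSep s i c)) (f (stripSep s i d)) := by
  induction i with
  | zero => exact fun c d hcd => hf.clique_init c d hcd
  | succ i ih =>
    intro c d hcd
    by_cases h : c = s i <;> by_cases h' : d = s i
    · exact absurd (h.trans h'.symm) hcd
    · rw [h, stripSep_succ_self, stripSep_succ_of_ne s h']
      exact (hf.adj i (by omega) d).symm
    · rw [h', stripSep_succ_self, stripSep_succ_of_ne s h]
      exact hf.adj i (by omega) c
    · rw [stripSep_succ_of_ne s h, stripSep_succ_of_ne s h']
      exact ih (by omega) hcd

/-- Every vertex of a separator has a neighbour reachable from the first vertex through earlier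
vertices outside the separator. -/
theorem exists_adj_reach (hf : IsStripEmbedding U k s f) {i : ℕ} (hi : i ≤ k) (c : Fin t) :
    ∃ w, U.Adj w (f (stripSep s i c)) ∧
      ReachAvoiding U (Set.range (f ∘ stripSep s i) ∪
        {v | ∃ j, i ≤ j ∧ j ≤ k ∧ v = f (t + 1 + j)}) (f t) w := by
  induction i generalizing c with
  | zero => exact ⟨f t, hf.adj_init c, .refl⟩
  | succ i ih =>
    have hsub : Set.range (f ∘ stripSep s (i + 1)) ∪
          {v | ∃ j, i + 1 ≤ j ∧ j ≤ k ∧ v = f (t + 1 + j)} ⊆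
        Set.range (f ∘ stripSep s i) ∪ {v | ∃ j, i ≤ j ∧ j ≤ k ∧ v = f (t + 1 + j)} := by
      rintro v (hv | ⟨j, hij, hj, rfl⟩)
      · rcases range_succ_subset i hv with rfl | hv
        · exact .inr ⟨i, le_rfl, by omega, rfl⟩
        · exact .inl hv
      · exact .inr ⟨j, by omega, hj, rfl⟩
    by_cases h : c = s i
    · obtain ⟨w, hw, hr⟩ := ih (by omega) (s i)
      subst h
      refine ⟨f (stripSep s i (s i)), ?_, (hr.mono hsub).step hw ?_⟩
      · rw [stripSep_succ_self]
        exact hf.adj i (by omega) (s i)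
      · rintro (hv | ⟨j, hij, hj, hv⟩)
        · exact hf.replaced_notMem hi hv
        · have := stripSep_lt s i (s i)
          have := hf.inj _ _ (by omega) (by omega) hv
          omega
    · obtain ⟨w, hw, hr⟩ := ih (by omega) c
      exact ⟨w, by rwa [stripSep_succ_of_ne s h], hr.mono hsub⟩

/-- In a `K_{t+2}`-minor-free graph, each separator of an embedded `t`-path separates its first
vertex from its last one. -/
theorem not_reach (hf : IsStripEmbedding U k s f)
    (hU : ¬ U.HasMinor (⊤ : SimpleGraph (Fin (t + 2)))) {i : ℕ} (hi : i ≤ k) :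
    ¬ ReachAvoiding U (Set.range (f ∘ stripSep s i)) (f t) (f (t + 1 + k)) := by
  intro hreach
  set S := Set.range (f ∘ stripSep s i) with hS
  set R := {v | ∃ j, i ≤ j ∧ j ≤ k ∧ v = f (t + 1 + j)} with hR
  have hxR : f t ∉ R := by
    rintro ⟨j, hij, hj, h⟩
    have := hf.inj _ _ (by omega) (by omega) h
    omega
  have hxS : f t ∉ S := by
    rintro ⟨c, hc⟩
    have h := stripSep_lt s i c
    exact stripSep_ne s i c (hf.inj _ _ (by omega) (by omega) hc)
  have hxSR : f t ∉ S ∪ R := by simp [hxS, hxR]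
  refine hU (hasMinor_top_of_clique (hf.clique hi) (U.induce_connected_reachAvoiding (S ∪ R) (f t))
    (R := R) ?_ ?_ ?_ ?_ ?_ ?_ ?_)
  · have hiR : f (t + 1 + i) ∈ R := ⟨i, le_rfl, hi, rfl⟩
    refine induce_connected_of_reflTransGen hiR ?_
    rintro _ ⟨j, hij, hj, rfl⟩
    induction j, hij using Nat.le_induction with
    | base => exact .refl
    | succ j hij ih =>
      exact (ih (by omega)).tail ⟨hf.adj_succ hj, j + 1, by omega, hj, rfl⟩
  · rw [Set.disjoint_left]
    exact fun v hv hvR => hv.notMem hxSR (.inr hvR)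
  · exact fun c hv => hv.notMem hxSR (.inl ⟨c, rfl⟩)
  · rintro c ⟨j, hij, hj, h⟩
    exact hf.notMem_range hij hj ⟨c, h⟩
  · intro c
    obtain ⟨w, hw, hr⟩ := hf.exists_adj_reach hi c
    exact ⟨w, hr, hw⟩
  · exact fun c => ⟨_, ⟨i, le_rfl, hi, rfl⟩, (hf.adj i hi c).symm⟩
  · exact hreach.exists_adj_of_mem hxR ⟨k, hi, le_rfl, rfl⟩

theorem reach_replaced (hf : IsStripEmbedding U k s f) {i : ℕ} (hi : i < k) :
    ReachAvoiding U (Set.range (f ∘ stripSep s (i + 1))) (f t) (f (stripSep s i (s i))) := by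
  obtain ⟨w, hw, hr⟩ := hf.exists_adj_reach hi.le (s i)
  refine (hr.mono ?_).step hw (hf.replaced_notMem hi)
  intro v hv
  rcases range_succ_subset i hv with rfl | hv
  · exact .inr ⟨i, le_rfl, hi.le, rfl⟩
  · exact .inl hv

theorem range_zero_subset (hU : ¬ U.HasMinor (⊤ : SimpleGraph (Fin (t + 2))))
    (hf : IsStripEmbedding U k s f) (hg : IsStripEmbedding U k s' g)
    (hfirst : f t = g t) (hlast : f (t + 1 + k) = g (t + 1 + k)) :
    Set.range (f ∘ stripSep s 0) ⊆ Set.range (g ∘ stripSep s' 0) := by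
  rintro _ ⟨c, rfl⟩
  by_contra hc
  apply hg.not_reach hU (Nat.zero_le k)
  have hxc : ReachAvoiding U (Set.range (g ∘ stripSep s' 0)) (g t) (f (stripSep s 0 c)) :=
    ReachAvoiding.step .refl (hfirst ▸ hf.adj_init c) hc
  have havoid : ∀ l, 0 ≤ l → l ≤ k → f (t + 1 + l) ∉ Set.range (g ∘ stripSep s' 0) := by
    rintro l - hl ⟨d, hd⟩
    apply hf.not_reach hU (Nat.zero_le k)
    refine hf.reach_last hl (fun j _ hj => hf.notMem_range (Nat.zero_le j) hj) ?_
    refine ReachAvoiding.step .refl ?_ (hf.notMem_range (Nat.zero_le l) hl)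
    rw [← hd, hfirst]
    exact hg.adj_init d
  rw [← hlast]
  exact hf.reach_last (Nat.zero_le k) havoid
    (hxc.step (hf.adj 0 (Nat.zero_le k) c) (havoid 0 le_rfl (Nat.zero_le k)))

/-- Two embedded `t`-paths with the same ends and the same `i`-th separator also agree in the next
vertex and in the vertex it replaces. -/
theorem next_eq (hU : ¬ U.HasMinor (⊤ : SimpleGraph (Fin (t + 2))))
    (hf : IsStripEmbedding U k s f) (hg : IsStripEmbedding U k s' g)
    (hlast : f (t + 1 + k) = g (t + 1 + k)) {i : ℕ} (hi : i < k)
    (hS : Set.range (f ∘ stripSep s i) = Set.range (g ∘ stripSep s' i)) :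
    f (t + 1 + i) = g (t + 1 + i) ∧ f (stripSep s i (s i)) = g (stripSep s' i (s' i)) := by
  have hd : f (stripSep s i (s i)) ∈ Set.range (g ∘ stripSep s' i) := hS ▸ ⟨s i, rfl⟩
  have hd' : g (stripSep s' i (s' i)) ∈ Set.range (f ∘ stripSep s i) := hS ▸ ⟨s' i, rfl⟩
  have hmem : ∀ l, i ≤ l → l ≤ k → g (t + 1 + l) ∈ Set.range (f ∘ stripSep s (i + 1)) →
      g (t + 1 + l) = f (t + 1 + i) := by
    intro l hil hl h
    rcases range_succ_subset i h with h | h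
    · exact h
    · exact absurd (hS ▸ h) (hg.notMem_range hil hl)
  have hnext : f (t + 1 + i) = g (t + 1 + i) := by
    have : ∃ j, i ≤ j ∧ j ≤ k ∧ g (t + 1 + j) ∈ Set.range (f ∘ stripSep s (i + 1)) := by
      by_contra! hno
      apply hf.not_reach hU (i := i + 1) hi
      rw [hlast]
      obtain ⟨c, hc⟩ := hd
      refine hg.reach_last hi.le hno ((hf.reach_replaced hi).step ?_ (hno i le_rfl hi.le))
      rw [← hc]
      exact hg.adj i hi.le c
    obtain ⟨j, hij, hj, hjm⟩ := this
    have hji := hmem j hij hj hjm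
    rcases hij.eq_or_lt with rfl | hij
    · exact hji.symm
    exfalso
    apply hg.not_reach hU (i := i + 1) hi
    obtain ⟨c, hc⟩ := hd'
    refine hg.reach_last hj (fun l hl hlk => hg.notMem_range (by omega) hlk)
      ((hg.reach_replaced hi).step ?_ (hg.notMem_range hij hj))
    rw [← hc, hji]
    exact hf.adj i hi.le c
  refine ⟨hnext, ?_⟩
  by_contra hne
  obtain ⟨c, hc⟩ := hd
  have hcs : c ≠ s' i := by
    rintro rfl
    exact hne hc.symm
  have hno : ∀ l, i + 1 ≤ l → l ≤ k →
      g (t + 1 + l) ∉ Set.range (f ∘ stripSep s (i + 1)) := by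
    intro l hl hlk h
    have := hg.inj _ _ (by omega) (by omega) ((hmem l (by omega) hlk h).trans hnext)
    omega
  apply hf.not_reach hU (i := i + 1) hi
  rw [hlast]
  refine hg.reach_last hi hno ((hf.reach_replaced hi).step ?_ (hno _ le_rfl hi))
  rw [← hc, Function.comp_apply, ← stripSep_succ_of_ne s' hcs]
  exact hg.adj (i + 1) hi c

/-- The ends of an embedded `t`-path determine its replacement sequence up to a permutation. -/
theorem exists_injective_eq (hU : ¬ U.HasMinor (⊤ : SimpleGraph (Fin (t + 2))))
    (hf : IsStripEmbedding U k s f) (hg : IsStripEmbedding U k s' g)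
    (hfirst : f t = g t) (hlast : f (t + 1 + k) = g (t + 1 + k)) :
    ∃ σ : Fin t → Fin t, Function.Injective σ ∧ ∀ i < k, s' i = σ (s i) := by
  choose σ hσ using fun c => range_zero_subset hU hf hg hfirst hlast ⟨c, rfl⟩
  have hσinj : Function.Injective σ := by
    intro c d hcd
    apply hf.injective (Nat.zero_le k)
    rw [← hσ, ← hσ, hcd]
  have hσsurj : Function.Surjective σ := Finite.surjective_of_injective hσinj
  have hstep : ∀ i < k, (∀ c, g (stripSep s' i (σ c)) = f (stripSep s i c)) →
      f (t + 1 + i) = g (t + 1 + i) ∧ s' i = σ (s i) := by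
    intro i hi h
    have hS : Set.range (f ∘ stripSep s i) = Set.range (g ∘ stripSep s' i) := by
      rw [← hσsurj.range_comp (g ∘ stripSep s' i)]
      congr 1
      funext c
      exact (h c).symm
    obtain ⟨h1, h2⟩ := next_eq hU hf hg hlast hi hS
    exact ⟨h1, hg.injective hi.le (by simp [h, h2])⟩
  have hall : ∀ i ≤ k, ∀ c, g (stripSep s' i (σ c)) = f (stripSep s i c) := by
    intro i
    induction i with
    | zero => exact fun _ c => hσ c
    | succ i ih =>
      intro hi c
      obtain ⟨h1, h2⟩ := hstep i hi (ih (by omega))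
      by_cases hc : c = s i
      · rw [hc, ← h2, stripSep_succ_self, stripSep_succ_self, h1]
      · have : σ c ≠ s' i := fun h => hc (hσinj (h.trans h2))
        rw [stripSep_succ_of_ne s hc, stripSep_succ_of_ne s' this]
        exact ih (by omega) c
  exact ⟨σ, hσinj, fun i hi => (hstep i hi (hall i hi.le)).2⟩

end IsStripEmbedding

/-- The replacement sequence that starts with `0` and continues according to the bits `b`. -/
def bitSeq {t m : ℕ} (ht : 2 ≤ t) (b : Fin m → Bool) (i : ℕ) : Fin t :=
  if h : 1 ≤ i ∧ i ≤ m then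
    if b ⟨i - 1, by omega⟩ then ⟨1, by omega⟩ else ⟨0, by omega⟩
  else ⟨0, by omega⟩

theorem bitSeq_injective_of_comp {t m : ℕ} (ht : 2 ≤ t) {b b' : Fin m → Bool} {σ : Fin t → Fin t}
    (hσ : Function.Injective σ) (h : ∀ i < m + 1, bitSeq ht b' i = σ (bitSeq ht b i)) :
    b = b' := by
  have h0 : σ ⟨0, by omega⟩ = ⟨0, by omega⟩ := by simpa [bitSeq] using (h 0 (by omega)).symm
  have h1 : σ ⟨1, by omega⟩ ≠ ⟨0, by omega⟩ := by
    rw [← h0]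
    exact fun h => by simpa using hσ h
  funext i
  have hi := h (i + 1) (by omega)
  simp only [bitSeq, Nat.add_sub_cancel, Fin.eta] at hi
  have hcond : 1 ≤ (i : ℕ) + 1 ∧ (i : ℕ) + 1 ≤ m := by omega
  simp only [hcond, and_self, dif_pos] at hi
  cases hb : b i <;> cases hb' : b' i <;> simp only [hb, hb'] at hi ⊢
  · simp [h0] at hi
  · simp only [if_true, Bool.false_eq_true, if_false] at hi
    exact absurd hi.symm h1

theorem two_pow_le_sq_of_contains_strips {t m N : ℕ} (ht : 2 ≤ t) {U : SimpleGraph (Fin N)}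
    (hU : ¬ U.HasMinor (⊤ : SimpleGraph (Fin (t + 2))))
    (hcont : ∀ s : ℕ → Fin t, ContainsSub U (stripGraph s (t + (m + 1) + 2))) :
    2 ^ m ≤ N ^ 2 := by
  choose f hf using fun b : Fin m → Bool => (hcont (bitSeq ht b)).exists_isStripEmbedding
  have hinj : Function.Injective fun b => (f b t, f b (t + 1 + (m + 1))) := by
    intro b b' h
    obtain ⟨h1, h2⟩ := Prod.mk.inj h
    obtain ⟨σ, hσ, h⟩ := (hf b).exists_injective_eq hU (hf b') h1 h2
    exact bitSeq_injective_of_comp ht hσ h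
  simpa [sq] using Fintype.card_le_of_injective _ hinj

theorem hasPathwidthAtMost_bot {n k : ℕ} (hn : 0 < n) :
    HasPathwidthAtMost (⊥ : SimpleGraph (Fin n)) k := by
  obtain ⟨m, rfl⟩ : ∃ m, n = m + 1 := ⟨n - 1, by omega⟩
  refine ⟨m, fun i => {i}, fun v => ⟨v, rfl⟩, fun _ _ h => absurd h id, ?_, by simp⟩
  rintro v i j l hij hjl rfl rfl
  exact le_antisymm hij hjl

/-- Let `n > t ≥ 2`. If a `K_{t+2}`-minor-free graph `U` contains every
`n`-vertex graph of pathwidth at most `t` as a subgraph, then `U` has at least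
`2^((n − t − 4)/t)` vertices. -/
theorem statement18 (t n : ℕ) (ht : 2 ≤ t) (hn : t < n)
    (N : ℕ) (U : SimpleGraph (Fin N))
    (hU : ¬ U.HasMinor (⊤ : SimpleGraph (Fin (t + 2))))
    (hcont : ∀ H : SimpleGraph (Fin n), HasPathwidthAtMost H t → ContainsSub U H) :
    (2 : ℝ) ^ (((n : ℝ) - t - 4) / (t : ℝ)) ≤ (N : ℝ) := by
  have hN : 1 ≤ N := by
    obtain ⟨f, -⟩ := hcont ⊥ (hasPathwidthAtMost_bot (by omega))
    have := (f ⟨0, by omega⟩).isLt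
    omega
  have hN' : (1 : ℝ) ≤ N := by exact_mod_cast hN
  have ht' : (2 : ℝ) ≤ t := by exact_mod_cast ht
  rcases lt_or_ge n (t + 4) with hlt | hge
  · have hlt' : (n : ℝ) < t + 4 := by exact_mod_cast hlt
    refine le_trans (Real.rpow_le_one_of_one_le_of_nonpos one_le_two ?_) hN'
    exact div_nonpos_of_nonpos_of_nonneg (by linarith) (by linarith)
  · obtain ⟨m, rfl⟩ : ∃ m, n = t + (m + 1) + 2 := ⟨n - t - 3, by omega⟩
    have hsq : 2 ^ m ≤ N ^ 2 := two_pow_le_sq_of_contains_strips ht hU fun s =>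
      hcont _ (stripGraph_hasPathwidthAtMost s (by omega))
    have hsq' : (2 : ℝ) ^ m ≤ (N : ℝ) ^ 2 := by exact_mod_cast hsq
    have hm : (0 : ℝ) ≤ m := Nat.cast_nonneg m
    have hexp : (((t + (m + 1) + 2 : ℕ) : ℝ) - t - 4) / t ≤ m / 2 := by
      rw [div_le_div_iff₀ (by linarith) (by norm_num)]
      push_cast
      nlinarith
    refine (Real.rpow_le_rpow_of_exponent_le one_le_two hexp).trans ?_
    refine le_of_sq_le_sq ?_ (by linarith)
    rw [← Real.rpow_natCast, ← Real.rpow_mul (by norm_num)]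
    simpa using hsq'
end

section
/- For all integers t ≥ 4 and n > t−2, if a finite simple K_t-minor-free graph U contains every n-vertex K_t-minor-free graph as a subgraph, then U has at least 2^{(n−t−2)/(t−2)} vertices. -/
open SimpleGraph

namespace SimpleGraph

variable {V : Type*} {G : SimpleGraph V}

theorem induce_singleton_connected (v : V) : (G.induce {v}).Connected :=
  Connected.of_subsingleton

theorem induce_insert_connected {X : Set V} (hX : (G.induce X).Connected) {u v : V} (hu : u ∈ X)
    (huv : G.Adj u v) : (G.induce (insert v X)).Connected := by
  have h := induce_union_connected (induce_pair_connected_of_adj huv).preconnected hX.preconnected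
    ⟨u, by simp, hu⟩
  have e : ({u, v} ∪ X : Set V) = insert v X := by
    ext w
    simp only [Set.mem_union, Set.mem_insert_iff, Set.mem_singleton_iff]
    grind
  rwa [e] at h

theorem induce_image_Icc_connected {f : ℕ → V} {a b : ℕ} (hab : a ≤ b)
    (hf : ∀ i, a ≤ i → i < b → G.Adj (f i) (f (i + 1))) :
    (G.induce (f '' Set.Icc a b)).Connected := by
  induction b, hab using Nat.le_induction with
  | base =>
    rw [Set.Icc_self, Set.image_singleton]
    exact induce_singleton_connected (f a)
  | succ b hab ih =>
    have h := induce_insert_connected (ih fun i h₁ h₂ => hf i h₁ (by lia))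
      (Set.mem_image_of_mem f (Set.right_mem_Icc.2 hab)) (hf b hab (by lia))
    rwa [← Set.image_insert_eq, Set.insert_Icc_right_eq_Icc_add_one (by lia)] at h

/-- Grow a connected set `X` along a connected set `R` until it touches `S`. -/
theorem exists_connected_adj_of_connected {R S X : Set V} (hR : (G.induce R).Connected)
    {w y : V} (hwR : w ∈ R) (hwX : w ∈ X) (hyR : y ∈ R) (hyS : y ∈ S)
    (hX : (G.induce X).Connected) (hXS : Disjoint X S) :
    ∃ Y, X ⊆ Y ∧ (G.induce Y).Connected ∧ Disjoint Y S ∧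
      ∃ z ∈ S, z ∈ R ∧ ∃ u ∈ Y, G.Adj u z := by
  obtain ⟨p⟩ := hR.preconnected ⟨w, hwR⟩ ⟨y, hyR⟩
  suffices H : ∀ (w y : R) (_ : (G.induce R).Walk w y) (X : Set V), (w : V) ∈ X → (y : V) ∈ S →
      (G.induce X).Connected → Disjoint X S → ∃ Y, X ⊆ Y ∧ (G.induce Y).Connected ∧
      Disjoint Y S ∧ ∃ z ∈ S, z ∈ R ∧ ∃ u ∈ Y, G.Adj u z from H _ _ p X hwX hyS hX hXS
  intro w y p
  induction p with
  | nil => exact fun X h₁ h₂ _ h => (Set.disjoint_left.1 h h₁ h₂).elim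
  | @cons w w' y h p ih =>
    intro X hw hy hX hXS
    have hadj : G.Adj w w' := h
    by_cases hS : (w' : V) ∈ S
    · exact ⟨X, subset_rfl, hX, hXS, w', hS, w'.2, w, hw, hadj⟩
    · obtain ⟨Y, hY, h⟩ := ih (insert (w' : V) X) (Set.mem_insert _ _) hy
        (induce_insert_connected hX hw hadj) (Set.disjoint_insert_left.2 ⟨hS, hXS⟩)
      exact ⟨Y, (Set.subset_insert _ _).trans hY, h⟩

theorem hasMinor_top_of_clique_s19 {k : ℕ} {g : Fin k → V} (hg : ∀ i j, i ≠ j → G.Adj (g i) (g j))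
    {X : Set V} (hX : (G.induce X).Connected) (hgX : ∀ i, g i ∉ X)
    (hadj : ∀ i, ∃ u ∈ X, G.Adj u (g i)) :
    G.HasMinor (⊤ : SimpleGraph (Fin (k + 1))) := by
  refine ⟨Fin.cons X fun i => {g i}, ?_, ?_, ?_⟩
  · intro b
    cases b using Fin.cases with
    | zero => exact hX
    | succ i => exact induce_singleton_connected _
  · intro b c hbc
    cases b using Fin.cases with
    | zero =>
      cases c using Fin.cases with
      | zero => exact (hbc rfl).elim
      | succ j => simpa using hgX j
    | succ i =>
      cases c using Fin.cases with
      | zero => simpa using hgX i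
      | succ j => simpa using (hg i j (by simpa using hbc)).ne
  · intro b c hbc
    rw [top_adj] at hbc
    cases b using Fin.cases with
    | zero =>
      cases c using Fin.cases with
      | zero => exact (hbc rfl).elim
      | succ j =>
        obtain ⟨u, hu, h⟩ := hadj j
        exact ⟨u, hu, g j, rfl, h⟩
    | succ i =>
      cases c using Fin.cases with
      | zero =>
        obtain ⟨u, hu, h⟩ := hadj i
        exact ⟨g i, rfl, u, hu, h.symm⟩
      | succ j => exact ⟨g i, rfl, g j, rfl, hg i j (by simpa using hbc)⟩

/-- Two vertices complete to a clique and joined by a connected set avoiding it. -/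
theorem hasMinor_top_of_two_apices {k : ℕ} {g : Fin k → V}
    (hg : ∀ i j, i ≠ j → G.Adj (g i) (g j)) {c d : V} (hc : ∀ i, G.Adj c (g i))
    (hd : ∀ i, G.Adj d (g i)) (hcd : c ≠ d) {R : Set V} (hR : (G.induce R).Connected)
    (hcR : c ∈ R) (hdR : d ∈ R) (hgR : ∀ i, g i ∉ R) :
    G.HasMinor (⊤ : SimpleGraph (Fin (k + 2))) := by
  obtain ⟨Y, hY, hYc, hYS, z, hzS, hzR, u, hu, huz⟩ :=
    exists_connected_adj_of_connected (S := insert d (Set.range g)) hR hcR (Set.mem_singleton c)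
      hdR (Set.mem_insert _ _) (induce_singleton_connected (G := G) c) (by
        rw [Set.disjoint_singleton_left]
        rintro (h | ⟨i, h⟩)
        · exact hcd h
        · exact hgR i (h ▸ hcR))
  have hcY : c ∈ Y := hY rfl
  have hz : z = d := by
    rcases hzS with h | ⟨i, rfl⟩
    · exact h
    · exact (hgR i hzR).elim
  subst hz
  refine hasMinor_top_of_clique_s19 (g := (Fin.cons z g : Fin (k + 1) → V)) ?_ hYc ?_ ?_
  · intro i j hij
    cases i using Fin.cases with
    | zero =>
      cases j using Fin.cases with
      | zero => exact (hij rfl).elim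
      | succ j => exact hd j
    | succ i =>
      cases j using Fin.cases with
      | zero => exact (hd i).symm
      | succ j => exact hg i j (by simpa using hij)
  · intro i h
    refine Set.disjoint_left.1 hYS h ?_
    cases i using Fin.cases with
    | zero => exact Set.mem_insert _ _
    | succ i => exact Set.mem_insert_of_mem _ ⟨i, rfl⟩
  · intro i
    cases i using Fin.cases with
    | zero => exact ⟨u, hu, huz⟩
    | succ i => exact ⟨c, hcY, hc i⟩

/-- Deleting a vertex whose neighbourhood is a clique preserves connectivity. -/
theorem induce_diff_singleton_connected {S : Set V} {v : V}
    (hS : (G.induce S).Connected) (hne : (S \ {v}).Nonempty)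
    (hv : ∀ u ∈ S, ∀ w ∈ S, G.Adj v u → G.Adj v w → u ≠ w → G.Adj u w) :
    (G.induce (S \ {v})).Connected := by
  have key : ∀ (u w : S) (_ : (G.induce S).Walk u w) (hw : (w : V) ≠ v),
      (∀ hu : (u : V) ≠ v,
        (G.induce (S \ {v})).Reachable ⟨u, u.2, hu⟩ ⟨w, w.2, hw⟩) ∧
      ((u : V) = v → ∀ u' (hu' : u' ∈ S \ {v}), G.Adj v u' →
        (G.induce (S \ {v})).Reachable ⟨u', hu'⟩ ⟨w, w.2, hw⟩) := by
    intro u w p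
    induction p with
    | nil => exact fun hw => ⟨fun _ => Reachable.rfl, fun h => (hw h).elim⟩
    | @cons u u₁ w h p ih =>
      intro hw
      have hadj : G.Adj u u₁ := h
      obtain ⟨ih₁, ih₂⟩ := ih hw
      refine ⟨fun hu => ?_, fun hu u' hu' hvu' => ?_⟩
      · by_cases h₁ : (u₁ : V) = v
        · exact ih₂ h₁ u ⟨u.2, hu⟩ (h₁ ▸ hadj.symm)
        · refine Reachable.trans (Adj.reachable ?_) (ih₁ h₁)
          exact hadj
      · have h₁ : (u₁ : V) ≠ v := fun h => hadj.ne (hu.trans h.symm)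
        by_cases he : u' = u₁
        · subst he
          exact ih₁ h₁
        · refine Reachable.trans (Adj.reachable ?_) (ih₁ h₁)
          exact hv u' hu'.1 u₁ u₁.2 hvu' (hu ▸ hadj) he
  obtain ⟨x, hx⟩ := hne
  have : Nonempty ↥(S \ {v}) := ⟨⟨x, hx⟩⟩
  refine ⟨fun a b => ?_⟩
  obtain ⟨p⟩ := hS.preconnected ⟨a, a.2.1⟩ ⟨b, b.2.1⟩
  exact (key _ _ p b.2.2).1 a.2.2

/-- A graph on `Fin n` in which the earlier neighbours of every vertex form a clique of size at
most `k` has no `K_{k+2}` minor. -/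
theorem not_hasMinor_top_of_elimination {n k : ℕ} {H : SimpleGraph (Fin n)}
    (hcl : ∀ v u w, u < v → w < v → H.Adj v u → H.Adj v w → u ≠ w → H.Adj u w)
    (hcard : ∀ v, {u | u < v ∧ H.Adj v u}.ncard ≤ k) :
    ¬ H.HasMinor (⊤ : SimpleGraph (Fin (k + 2))) := by
  suffices key : ∀ j : ℕ, ∀ B : Fin (k + 2) → Set (Fin n), (∀ b, (H.induce (B b)).Connected) →
      (Pairwise fun b b' => Disjoint (B b) (B b')) →
      (∀ b b', b ≠ b' → ∃ u ∈ B b, ∃ v ∈ B b', H.Adj u v) →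
      (∀ b, ∀ v ∈ B b, v.val < j) → False by
    rintro ⟨B, h₁, h₂, h₃⟩
    exact key n B h₁ h₂ (fun b b' h => h₃ b b' h) fun _ v _ => v.2
  intro j
  induction j with
  | zero =>
    intro B hB _ _ hj
    obtain ⟨⟨v, hv⟩⟩ := (hB 0).nonempty
    exact absurd (hj 0 v hv) (by simp)
  | succ j ih =>
    intro B hB hdis hadj hj
    by_cases hex : ∃ b₀, ∃ v ∈ B b₀, v.val = j
    swap
    · push Not at hex
      exact ih B hB hdis hadj fun b v hv => by
        have := hj b v hv
        have := hex b v hv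
        lia
    obtain ⟨b₀, v, hv, hvj⟩ := hex
    have hlt : ∀ b, ∀ u ∈ B b, u ≠ v → u < v := fun b u hu hne => by
      have := hj b u hu
      have : u.val ≠ v.val := fun h => hne (Fin.ext h)
      rw [Fin.lt_def]
      lia
    have hout : ∀ b, b ≠ b₀ → v ∉ B b := fun b hb h => Set.disjoint_left.1 (hdis hb) h hv
    have hne : ∃ w ∈ B b₀, w ≠ v := by
      by_contra! hall
      have hch : ∀ i : Fin (k + 1), ∃ u ∈ B (b₀.succAbove i), H.Adj v u := fun i => by
        obtain ⟨x, hx, y, hy, hxy⟩ := hadj b₀ (b₀.succAbove i) (Fin.succAbove_ne _ _).symm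
        exact ⟨y, hy, hall x hx ▸ hxy⟩
      choose g hgB hg using hch
      have hinj : Function.Injective g := fun i i' h => by
        by_contra hii
        exact Set.disjoint_left.1 (hdis (fun e => hii (Fin.succAbove_right_injective e)))
          (hgB i) (h ▸ hgB i')
      have hsub : Set.range g ⊆ {u | u < v ∧ H.Adj v u} := by
        rintro _ ⟨i, rfl⟩
        exact ⟨hlt _ _ (hgB i) (hg i).ne', hg i⟩
      have h₁ := Set.ncard_le_ncard hsub (Set.toFinite _)
      rw [Set.ncard_range_of_injective hinj, Nat.card_fin] at h₁
      have := hcard v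
      lia
    obtain ⟨w, hw, hwv⟩ := hne
    have hnb : ∃ u ∈ B b₀, H.Adj v u := by
      obtain ⟨p⟩ := (hB b₀).preconnected ⟨v, hv⟩ ⟨w, hw⟩
      cases p with
      | nil => exact (hwv rfl).elim
      | @cons _ u _ h _ => exact ⟨u, u.2, h⟩
    obtain ⟨u, hu, hvu⟩ := hnb
    have hedge : ∀ b b', b ≠ b' → v ∉ B b' →
        ∃ u ∈ B b \ {v}, ∃ w ∈ B b' \ {v}, H.Adj u w := by
      intro b b' hbb hvb'
      obtain ⟨x, hx, y, hy, hxy⟩ := hadj b b' hbb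
      have hyv : y ≠ v := fun h => hvb' (h ▸ hy)
      by_cases hxv : x = v
      · subst hxv
        obtain rfl : b = b₀ := by
          by_contra h
          exact hout b h hx
        exact ⟨u, ⟨hu, hvu.ne'⟩, y, ⟨hy, hyv⟩, hcl x u y (hlt _ _ hu hvu.ne') (hlt _ _ hy hyv)
          hvu hxy fun h => Set.disjoint_left.1 (hdis hbb) hu (h ▸ hy)⟩
      · exact ⟨x, ⟨hx, hxv⟩, y, ⟨hy, hyv⟩, hxy⟩
    refine ih (fun b => B b \ {v}) ?_ ?_ ?_ ?_
    · intro b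
      by_cases hb : b = b₀
      · subst hb
        exact induce_diff_singleton_connected (hB b) ⟨w, hw, hwv⟩ fun x hx y hy hvx hvy =>
          hcl v x y (hlt _ _ hx hvx.ne') (hlt _ _ hy hvy.ne') hvx hvy
      · rw [Set.sdiff_singleton_eq_self (hout b hb)]
        exact hB b
    · exact fun b b' hbb => (hdis hbb).mono Set.sdiff_subset Set.sdiff_subset
    · intro b b' hbb
      by_cases hb : b' = b₀
      · obtain ⟨x, hx, y, hy, hxy⟩ := hedge b' b hbb.symm (hout b fun h => hbb (h.trans hb.symm))
        exact ⟨y, hy, x, hx, hxy.symm⟩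
      · exact hedge b b' hbb (hout b' hb)
    · intro b x hx
      have := hlt b x hx.1 hx.2
      rw [Fin.lt_def] at this
      lia

/-- The clique to which the vertex `k + j` of the `k`-path with string `s` is attached: initially
`{0, …, k - 1}`, and then the vertex `k + j` replaces the entry at position `s j`. -/
def front {k : ℕ} (s : ℕ → Fin k) : ℕ → Fin k → ℕ
  | 0 => fun i => i
  | j + 1 => Function.update (front s j) (s j) (k + j)

/-- The `k`-path on `ℕ` with string `s`. -/
def kPath {k : ℕ} (s : ℕ → Fin k) : SimpleGraph ℕ :=
  fromRel fun u v => u < v ∧ ∃ i, front s (v - k) i = u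

section kPath

variable {k : ℕ} (s : ℕ → Fin k)

theorem front_lt (j : ℕ) (i : Fin k) : front s j i < k + j := by
  induction j with
  | zero => exact i.2
  | succ j ih =>
    rw [front, Function.update_apply]
    split_ifs <;> lia

theorem front_succ_self (j : ℕ) : front s (j + 1) (s j) = k + j := by
  simp [front]

theorem front_succ_of_ne {j : ℕ} {i : Fin k} (h : i ≠ s j) : front s (j + 1) i = front s j i := by
  simp [front, h]

theorem kPath_adj_of_lt {u v : ℕ} (h : u < v) :
    (kPath s).Adj u v ↔ ∃ i, front s (v - k) i = u := by
  rw [kPath, fromRel_adj]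
  constructor
  · rintro ⟨_, h' | h'⟩
    · exact h'.2
    · exact absurd h'.1 (by lia)
  · exact fun h' => ⟨h.ne, Or.inl ⟨h, h'⟩⟩

theorem kPath_adj_front (j : ℕ) (i : Fin k) : (kPath s).Adj (k + j) (front s j i) := by
  rw [adj_comm, kPath_adj_of_lt s (front_lt s j i)]
  exact ⟨i, by simp⟩

theorem kPath_front_adj_front (j : ℕ) {i i' : Fin k} (h : i ≠ i') :
    (kPath s).Adj (front s j i) (front s j i') := by
  induction j with
  | zero =>
    have aux : ∀ a b : Fin k, a < b → (kPath s).Adj (front s 0 a) (front s 0 b) := by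
      intro a b hab
      rw [kPath_adj_of_lt s (by exact hab)]
      refine ⟨a, ?_⟩
      have : front s 0 b - k = 0 := Nat.sub_eq_zero_of_le b.2.le
      rw [this]
    rcases lt_or_gt_of_ne h with h | h
    · exact aux _ _ h
    · exact (aux _ _ h).symm
  | succ j ih =>
    by_cases h₁ : i = s j
    · subst h₁
      rw [front_succ_self, front_succ_of_ne s h.symm]
      exact kPath_adj_front s j i'
    · rw [front_succ_of_ne s h₁]
      by_cases h₂ : i' = s j
      · subst h₂
        rw [front_succ_self]
        exact (kPath_adj_front s j i).symm
      · rw [front_succ_of_ne s h₂]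
        exact ih

theorem kPath_adj_succ (j : ℕ) : (kPath s).Adj (k + j) (k + (j + 1)) := by
  have h := kPath_adj_front s (j + 1) (s j)
  rw [front_succ_self] at h
  exact h.symm

theorem kPath_not_hasMinor (n : ℕ) :
    ¬ ((kPath s).comap (Fin.val : Fin n → ℕ)).HasMinor (⊤ : SimpleGraph (Fin (k + 2))) := by
  apply not_hasMinor_top_of_elimination
  · intro v u w hu hw hvu hvw huw
    rw [comap_adj, adj_comm, kPath_adj_of_lt s hu] at hvu
    rw [comap_adj, adj_comm, kPath_adj_of_lt s hw] at hvw
    obtain ⟨i, hi⟩ := hvu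
    obtain ⟨i', hi'⟩ := hvw
    rw [comap_adj, ← hi, ← hi']
    refine kPath_front_adj_front s _ ?_
    rintro rfl
    exact huw (Fin.ext (hi.symm.trans hi'))
  · intro v
    rw [← Set.ncard_image_of_injective _ Fin.val_injective]
    calc _ ≤ (Set.range (front s (v - k))).ncard := by
          refine Set.ncard_le_ncard ?_ (Set.finite_range _)
          rintro _ ⟨u, ⟨hu, hvu⟩, rfl⟩
          rw [comap_adj, adj_comm, kPath_adj_of_lt s hu] at hvu
          exact hvu
      _ ≤ k := by
          rw [← Set.image_univ]
          exact (Set.ncard_image_le Set.finite_univ).trans (by simp)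

end kPath

/-- `f` embeds the first `n` vertices of the `k`-path with string `s` into `G`. -/
structure IsKPathEmbedding (G : SimpleGraph V) {k : ℕ} (s : ℕ → Fin k) (n : ℕ) (f : ℕ → V) :
    Prop where
  injOn : Set.InjOn f (Set.Iio n)
  map_adj : ∀ u < n, ∀ v < n, (kPath s).Adj u v → G.Adj (f u) (f v)

theorem _root_.ContainsSub.exists_isKPathEmbedding {k : ℕ} {s : ℕ → Fin k} {n : ℕ} (hn : 0 < n)
    (h : ContainsSub G ((kPath s).comap (Fin.val : Fin n → ℕ))) :
    ∃ f, IsKPathEmbedding G s n f := by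
  obtain ⟨f, hf, hadj⟩ := h
  refine ⟨fun v => if h : v < n then f ⟨v, h⟩ else f ⟨0, hn⟩, ?_, ?_⟩
  · intro u hu v hv huv
    rw [Set.mem_Iio] at hu hv
    simpa [hu, hv, hf.eq_iff] using huv
  · intro u hu v hv huv
    simp only [hu, hv, dite_true]
    exact hadj _ _ huv

namespace IsKPathEmbedding

variable {k m : ℕ} {s s' : ℕ → Fin k} {f f' : ℕ → V}

theorem ne (P : IsKPathEmbedding G s (k + m + 1) f) {u v : ℕ} (hu : u ≤ k + m) (hv : v ≤ k + m)
    (h : u ≠ v) : f u ≠ f v :=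
  fun e => h (P.injOn (Set.mem_Iio.2 (by lia)) (Set.mem_Iio.2 (by lia)) e)

theorem adj_front (P : IsKPathEmbedding G s (k + m + 1) f) {j : ℕ} (hj : j ≤ m) (i : Fin k) :
    G.Adj (f (k + j)) (f (front s j i)) :=
  P.map_adj _ (by lia) _ (by have := front_lt s j i; lia) (kPath_adj_front s j i)

theorem front_adj_front (P : IsKPathEmbedding G s (k + m + 1) f) {j : ℕ} (hj : j ≤ m)
    (i i' : Fin k) (h : i ≠ i') : G.Adj (f (front s j i)) (f (front s j i')) :=
  P.map_adj _ (by have := front_lt s j i; lia) _ (by have := front_lt s j i'; lia)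
    (kPath_front_adj_front s j h)

theorem tail_connected (P : IsKPathEmbedding G s (k + m + 1) f) {j : ℕ} (hj : j ≤ m) :
    (G.induce (f '' Set.Icc (k + j) (k + m))).Connected := by
  refine induce_image_Icc_connected (by lia) fun i h₁ h₂ => ?_
  obtain ⟨l, rfl⟩ := Nat.exists_eq_add_of_le (show k ≤ i by lia)
  exact P.map_adj _ (by lia) _ (by lia) (kPath_adj_succ s l)

theorem notMem_tail (P : IsKPathEmbedding G s (k + m + 1) f) {j u : ℕ} (hj : j ≤ m)
    (hu : u < k + j) : f u ∉ f '' Set.Icc (k + j) (k + m) := by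
  rintro ⟨v, ⟨h₁, h₂⟩, h⟩
  exact P.ne h₂ (by lia) (by lia) h

theorem front_notMem_tail (P : IsKPathEmbedding G s (k + m + 1) f) {j : ℕ} (hj : j ≤ m)
    (i : Fin k) : f (front s j i) ∉ f '' Set.Icc (k + j) (k + m) :=
  P.notMem_tail hj (front_lt s j i)

theorem tails_connected (P : IsKPathEmbedding G s (k + m + 1) f)
    (P' : IsKPathEmbedding G s' (k + m + 1) f') (hy : f (k + m) = f' (k + m)) {j : ℕ}
    (hj : j ≤ m) :
    (G.induce (f '' Set.Icc (k + j) (k + m) ∪ f' '' Set.Icc (k + j) (k + m))).Connected :=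
  induce_union_connected (P.tail_connected hj).preconnected (P'.tail_connected hj).preconnected
    ⟨f (k + m), Set.mem_image_of_mem f (Set.right_mem_Icc.2 (by lia)), hy ▸
      Set.mem_image_of_mem f' (Set.right_mem_Icc.2 (by lia))⟩

theorem next_eq (hG : ¬ G.HasMinor (⊤ : SimpleGraph (Fin (k + 2))))
    (P : IsKPathEmbedding G s (k + m + 1) f) (P' : IsKPathEmbedding G s' (k + m + 1) f')
    (hy : f (k + m) = f' (k + m)) {j : ℕ} (hj : j ≤ m)
    (hQ : ∀ i, f (front s j i) = f' (front s' j i)) : f (k + j) = f' (k + j) := by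
  by_contra hne
  refine hG (hasMinor_top_of_two_apices (P.front_adj_front hj) (P.adj_front hj)
    (fun i => hQ i ▸ P'.adj_front hj i) hne (P.tails_connected P' hy hj)
    (Or.inl (Set.mem_image_of_mem f (Set.left_mem_Icc.2 (by lia))))
    (Or.inr (Set.mem_image_of_mem f' (Set.left_mem_Icc.2 (by lia)))) ?_)
  rintro i (h | h)
  · exact P.front_notMem_tail hj i h
  · exact P'.front_notMem_tail hj i (hQ i ▸ h)

theorem string_eq (hG : ¬ G.HasMinor (⊤ : SimpleGraph (Fin (k + 2))))
    (P : IsKPathEmbedding G s (k + m + 1) f) (P' : IsKPathEmbedding G s' (k + m + 1) f')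
    (hy : f (k + m) = f' (k + m)) {j : ℕ} (hj : j < m)
    (hQ : ∀ i, f (front s j i) = f' (front s' j i)) : s j = s' j := by
  by_contra hne
  have hc := next_eq hG P P' hy hj.le hQ
  refine hG (hasMinor_top_of_clique_s19
    (g := (Fin.cons (f (k + j)) fun i => f (front s j i) : Fin (k + 1) → V)) ?_
    (P.tails_connected P' hy (j := j + 1) hj) ?_ ?_)
  · intro a b hab
    cases a using Fin.cases with
    | zero =>
      cases b using Fin.cases with
      | zero => exact (hab rfl).elim
      | succ b => exact P.adj_front hj.le b
    | succ a =>
      cases b using Fin.cases with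
      | zero => exact (P.adj_front hj.le a).symm
      | succ b => exact P.front_adj_front hj.le a b (by simpa using hab)
  · intro a h
    cases a using Fin.cases with
    | zero =>
      rcases h with h | h
      · exact P.notMem_tail (j := j + 1) hj (by lia) h
      · rw [Fin.cons_zero, hc] at h
        exact P'.notMem_tail (j := j + 1) hj (by lia) h
    | succ a =>
      rcases h with h | h
      · exact P.notMem_tail (j := j + 1) hj ((front_lt s j a).trans (by lia)) h
      · rw [Fin.cons_succ, hQ a] at h
        exact P'.notMem_tail (j := j + 1) hj ((front_lt s' j a).trans (by lia)) h
  · have hmem : f (k + (j + 1)) ∈ f '' Set.Icc (k + (j + 1)) (k + m) :=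
      Set.mem_image_of_mem f (Set.left_mem_Icc.2 (by lia))
    have hmem' : f' (k + (j + 1)) ∈ f' '' Set.Icc (k + (j + 1)) (k + m) :=
      Set.mem_image_of_mem f' (Set.left_mem_Icc.2 (by lia))
    intro a
    cases a using Fin.cases with
    | zero =>
      have h := P.adj_front (j := j + 1) hj (s j)
      rw [front_succ_self] at h
      exact ⟨_, Or.inl hmem, h⟩
    | succ a =>
      by_cases ha : a = s j
      · have h := P'.adj_front (j := j + 1) hj a
        rw [front_succ_of_ne s' (ha ▸ hne), ← hQ] at h
        exact ⟨_, Or.inr hmem', h⟩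
      · have h := P.adj_front (j := j + 1) hj a
        rw [front_succ_of_ne s ha] at h
        exact ⟨_, Or.inl hmem, h⟩

/-- In a `K_{k+2}`-minor-free graph, the string of an embedded `k`-path is determined by the
ordered initial clique and the last vertex. -/
theorem string_unique (hG : ¬ G.HasMinor (⊤ : SimpleGraph (Fin (k + 2))))
    (P : IsKPathEmbedding G s (k + m + 1) f) (P' : IsKPathEmbedding G s' (k + m + 1) f')
    (h₀ : ∀ i : Fin k, f i = f' i) (hy : f (k + m) = f' (k + m)) : ∀ j < m, s j = s' j := by
  suffices key : ∀ j ≤ m, ∀ i, f (front s j i) = f' (front s' j i) from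
    fun j hj => string_eq hG P P' hy hj (key j hj.le)
  intro j
  induction j with
  | zero => exact fun _ => h₀
  | succ j ih =>
    intro hj i
    have hQ := ih (by lia)
    have hs := string_eq hG P P' hy hj hQ
    by_cases hi : i = s j
    · rw [hi, front_succ_self, hs, front_succ_self]
      exact next_eq hG P P' hy (by lia) hQ
    · rw [front_succ_of_ne s hi, front_succ_of_ne s' (hs ▸ hi)]
      exact hQ i

end IsKPathEmbedding

theorem Walk.induce_getVert_Icc_connected {a b : V} (p : G.Walk a b) {i j : ℕ} (hij : i ≤ j)
    (hj : j ≤ p.length) : (G.induce (p.getVert '' Set.Icc i j)).Connected :=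
  induce_image_Icc_connected hij fun l _ h => p.adj_getVert_succ (by lia)

/-- A cycle, given as a path `p` together with the edge joining its ends, and a connected set
adjacent to three vertices of the cycle yield a `K₄` minor. -/
theorem hasMinor_top_four_of_wheel {a b : V} {p : G.Walk a b} (hp : p.IsPath) (hab : G.Adj a b)
    {X : Set V} (hX : (G.induce X).Connected) (hXp : ∀ v ∈ p.support, v ∉ X)
    (ha : ∃ u ∈ X, G.Adj u a) (hb : ∃ u ∈ X, G.Adj u b) {z : V} (hz : z ∈ p.support)
    (hza : z ≠ a) (hzb : z ≠ b) (hzX : ∃ u ∈ X, G.Adj u z) :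
    G.HasMinor (⊤ : SimpleGraph (Fin 4)) := by
  obtain ⟨i, rfl, hi⟩ := Walk.mem_support_iff_exists_getVert.1 hz
  have hi₀ : i ≠ 0 := by
    rintro rfl
    exact hza p.getVert_zero
  have hiL : i ≠ p.length := by
    rintro rfl
    exact hzb p.getVert_length
  have hdis : ∀ {A B : Set ℕ}, (∀ x ∈ A, x ≤ p.length) → (∀ x ∈ B, x ≤ p.length) →
      Disjoint A B → Disjoint (p.getVert '' A) (p.getVert '' B) := by
    intro A B hA hB hAB
    rw [Set.disjoint_left]
    rintro _ ⟨x, hx, rfl⟩ ⟨y, hy, hxy⟩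
    have := hp.getVert_injOn (hB y hy) (hA x hx) hxy
    exact Set.disjoint_left.1 hAB hx (this ▸ hy)
  have hXd : ∀ A : Set ℕ, Disjoint X (p.getVert '' A) := by
    intro A
    rw [Set.disjoint_right]
    rintro _ ⟨x, _, rfl⟩
    exact hXp _ (p.getVert_mem_support x)
  set A := p.getVert '' Set.Icc 0 (i - 1)
  set Z := p.getVert '' Set.Icc i i
  set B := p.getVert '' Set.Icc (i + 1) p.length
  have haA : a ∈ A := ⟨0, by simp, p.getVert_zero⟩
  have hbB : b ∈ B := ⟨p.length, by simp; lia, p.getVert_length⟩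
  have hzZ : p.getVert i ∈ Z := ⟨i, by simp, rfl⟩
  have hAZ : Disjoint A Z := hdis (by simp; lia) (by simp; lia) (by
    rw [Set.disjoint_left]; simp; lia)
  have hAB : Disjoint A B := hdis (by simp; lia) (by simp) (by
    rw [Set.disjoint_left]; simp; lia)
  have hZB : Disjoint Z B := hdis (by simp; lia) (by simp) (by
    rw [Set.disjoint_left]; simp)
  have eAZ : ∃ u ∈ A, ∃ v ∈ Z, G.Adj u v := by
    refine ⟨_, ⟨i - 1, by simp, rfl⟩, _, hzZ, ?_⟩
    have := p.adj_getVert_succ (i := i - 1) (by lia)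
    rwa [Nat.sub_add_cancel (by lia)] at this
  have eZB : ∃ u ∈ Z, ∃ v ∈ B, G.Adj u v :=
    ⟨_, hzZ, _, ⟨i + 1, by simp; lia, rfl⟩, p.adj_getVert_succ (by lia)⟩
  have eAB : ∃ u ∈ A, ∃ v ∈ B, G.Adj u v := ⟨a, haA, b, hbB, hab⟩
  have eXA : ∃ u ∈ X, ∃ v ∈ A, G.Adj u v := ha.imp fun u h => ⟨h.1, a, haA, h.2⟩
  have eXZ : ∃ u ∈ X, ∃ v ∈ Z, G.Adj u v := hzX.imp fun u h => ⟨h.1, _, hzZ, h.2⟩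
  have eXB : ∃ u ∈ X, ∃ v ∈ B, G.Adj u v := hb.imp fun u h => ⟨h.1, b, hbB, h.2⟩
  have esymm : ∀ {S T : Set V}, (∃ u ∈ S, ∃ v ∈ T, G.Adj u v) → ∃ u ∈ T, ∃ v ∈ S, G.Adj u v :=
    fun ⟨u, hu, v, hv, h⟩ => ⟨v, hv, u, hu, h.symm⟩
  refine ⟨![X, A, Z, B], ?_, ?_, ?_⟩
  · intro c
    fin_cases c
    · exact hX
    · exact p.induce_getVert_Icc_connected (by lia) (by lia)
    · exact p.induce_getVert_Icc_connected (by lia) (by lia)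
    · exact p.induce_getVert_Icc_connected (by lia) le_rfl
  · intro c d hcd
    fin_cases c <;> fin_cases d <;> first
      | exact (hcd rfl).elim
      | exact hXd _
      | exact (hXd _).symm
      | assumption
      | (apply Disjoint.symm; assumption)
  · intro c d hcd
    fin_cases c <;> fin_cases d <;> first
      | exact (hcd rfl).elim
      | assumption
      | (apply esymm; assumption)

/-- A vertex `y` of a path can be joined to an end of the path within the path while avoiding a
given vertex other than `y`. -/
theorem Walk.IsPath.exists_connected_notMem {a b : V} {p : G.Walk a b} (hp : p.IsPath) {y c : V}
    (hy : y ∈ p.support) (hc : c ≠ y) :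
    ∃ R : Set V, (G.induce R).Connected ∧ (∀ v ∈ R, v ∈ p.support) ∧ y ∈ R ∧ c ∉ R ∧
      (a ∈ R ∨ b ∈ R) := by
  obtain ⟨i, rfl, hi⟩ := Walk.mem_support_iff_exists_getVert.1 hy
  have hsub : ∀ A : Set ℕ, ∀ v ∈ p.getVert '' A, v ∈ p.support := by
    rintro A _ ⟨x, _, rfl⟩
    exact p.getVert_mem_support x
  by_cases h : c ∈ p.getVert '' Set.Icc 0 i
  · refine ⟨_, p.induce_getVert_Icc_connected hi le_rfl, hsub _, ⟨i, by simpa using hi, rfl⟩, ?_,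
      Or.inr ⟨p.length, by simpa using hi, p.getVert_length⟩⟩
    rintro ⟨l', ⟨h₁, h₂⟩, rfl⟩
    obtain ⟨l, ⟨-, hl⟩, hll⟩ := h
    have : l = l' := hp.getVert_injOn (hl.trans hi) h₂ hll
    exact hc (by rw [show l' = i by lia])
  · exact ⟨_, p.induce_getVert_Icc_connected (Nat.zero_le i) hi, hsub _, ⟨i, by simp, rfl⟩, h,
      Or.inl ⟨0, by simp, p.getVert_zero⟩⟩

/-- If a vertex `x` is adjacent to both ends of two edges, each of which lies on a cycle through
`y` avoiding `x`, then the edges coincide or there is a `K₄` minor. -/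
theorem hasMinor_top_four_of_two_cycles {x y a b a' b' : V} {p : G.Walk a b} {p' : G.Walk a' b'}
    (hp : p.IsPath) (hp' : p'.IsPath) (hab : G.Adj a b) (hab' : G.Adj a' b')
    (hxp : x ∉ p.support) (hxp' : x ∉ p'.support) (hy : y ∈ p.support) (hy' : y ∈ p'.support)
    (ha'y : a' ≠ y) (hb'y : b' ≠ y) (hxa : G.Adj x a) (hxb : G.Adj x b) (hxa' : G.Adj x a')
    (hxb' : G.Adj x b') (haa' : a ≠ a') (hab'' : a ≠ b') :
    G.HasMinor (⊤ : SimpleGraph (Fin 4)) := by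
  have hx₀ : (G.induce {x}).Connected := induce_singleton_connected x
  have wheel : ∀ {X : Set V}, x ∈ X → (G.induce X).Connected → (∀ v ∈ p'.support, v ∉ X) →
      ∀ z ∈ p'.support, z ≠ a' → z ≠ b' → (∃ u ∈ X, G.Adj u z) →
      G.HasMinor (⊤ : SimpleGraph (Fin 4)) := fun hx hX hXp z hz h₁ h₂ h₃ =>
    hasMinor_top_four_of_wheel hp' hab' hX hXp ⟨x, hx, hxa'⟩ ⟨x, hx, hxb'⟩ hz h₁ h₂ h₃
  by_cases hboth : a' ∈ p.support ∧ b' ∈ p.support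
  · have hXp : ∀ v ∈ p.support, v ∉ ({x} : Set V) := by
      rintro v hv rfl
      exact hxp hv
    by_cases h : a' = b
    · exact hasMinor_top_four_of_wheel hp hab hx₀ hXp ⟨x, rfl, hxa⟩ ⟨x, rfl, hxb⟩ hboth.2
        hab''.symm (fun e => hab'.ne (h.trans e.symm)) ⟨x, rfl, hxb'⟩
    · exact hasMinor_top_four_of_wheel hp hab hx₀ hXp ⟨x, rfl, hxa⟩ ⟨x, rfl, hxb⟩ hboth.1
        haa'.symm h ⟨x, rfl, hxa'⟩
  obtain ⟨R, hR, hRp, hyR, ha'R, hb'R, hwR⟩ : ∃ R : Set V, (G.induce R).Connected ∧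
      (∀ v ∈ R, v ∈ p.support) ∧ y ∈ R ∧ a' ∉ R ∧ b' ∉ R ∧ (a ∈ R ∨ b ∈ R) := by
    by_cases h : a' ∈ p.support
    · obtain ⟨R, h₁, h₂, h₃, h₄, h₅⟩ := hp.exists_connected_notMem hy ha'y
      exact ⟨R, h₁, h₂, h₃, h₄, fun h' => hboth ⟨h, h₂ _ h'⟩, h₅⟩
    · obtain ⟨R, h₁, h₂, h₃, h₄, h₅⟩ := hp.exists_connected_notMem hy hb'y
      exact ⟨R, h₁, h₂, h₃, fun h' => h (h₂ _ h'), h₄, h₅⟩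
  obtain ⟨w, hw, hxw⟩ : ∃ w ∈ R, G.Adj x w := by
    rcases hwR with h | h
    · exact ⟨a, h, hxa⟩
    · exact ⟨b, h, hxb⟩
  have hX' : ∀ v ∈ p'.support, v ∉ ({x} : Set V) := by
    rintro v hv rfl
    exact hxp' hv
  by_cases hwp : w ∈ p'.support
  · exact wheel (Set.mem_singleton x) hx₀ hX' w hwp (fun h => ha'R (h ▸ hw)) (fun h => hb'R (h ▸ hw)) ⟨x, rfl, hxw⟩
  · obtain ⟨Y, hY, hYc, hYS, z, hzS, hzR, hz⟩ :=
      exists_connected_adj_of_connected (S := {v | v ∈ p'.support}) hR hw (Set.mem_insert w {x})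
        hyR hy' (induce_insert_connected hx₀ rfl hxw) (Set.disjoint_insert_left.2
          ⟨hwp, Set.disjoint_singleton_left.2 hxp'⟩)
    exact wheel (hY (by simp)) hYc (fun v hv h => Set.disjoint_left.1 hYS h hv) z hzS
      (fun h => ha'R (h ▸ hzR)) (fun h => hb'R (h ▸ hzR)) hz

namespace IsKPathEmbedding

variable {m : ℕ} {s s' : ℕ → Fin 2} {f f' : ℕ → V}

/-- The two vertex-disjoint paths from a clique of an embedded `2`-path to its last vertex. -/
theorem exists_path (P : IsKPathEmbedding G s (2 + m + 1) f) {j : ℕ} (hj : j ≤ m) {a b : ℕ}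
    (ha : a = front s j 0) (hb : b = front s j 1) :
    ∃ p : G.Walk (f a) (f b), p.IsPath ∧ f (2 + m) ∈ p.support ∧
      ∀ v ∈ p.support, ∃ q ≤ 2 + m, v = f q ∧ (q = a ∨ q = b ∨ 2 + j ≤ q) := by
  obtain ⟨d, rfl⟩ := Nat.exists_eq_add_of_le hj
  induction d generalizing j a b with
  | zero =>
    have h₀ := front_lt s j 0
    have h₁ := front_lt s j 1
    have hya := P.adj_front hj 0
    have hyb := P.adj_front hj 1
    have hab := (P.front_adj_front hj 0 1 (by decide)).ne
    rw [← ha] at h₀ hya hab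
    rw [← hb] at h₁ hyb hab
    refine ⟨.cons hya.symm (.cons hyb .nil), ?_, by simp, ?_⟩
    · simp [Walk.cons_isPath_iff, hab, hya.ne', hyb.ne]
    · intro v hv
      simp only [Walk.support_cons, Walk.support_nil, List.mem_cons, List.not_mem_nil,
        or_false] at hv
      rcases hv with rfl | rfl | rfl
      · exact ⟨a, by lia, rfl, by simp⟩
      · exact ⟨2 + j, by lia, rfl, by simp⟩
      · exact ⟨b, by lia, rfl, by simp⟩
  | succ d ih =>
    have h₀ := front_lt s j 0
    have h₁ := front_lt s j 1
    have hya := P.adj_front hj 0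
    have hyb := P.adj_front hj 1
    have hab : a ≠ b := fun h => (P.front_adj_front hj 0 1 (by decide)).ne (by rw [← ha, ← hb, h])
    rw [← ha] at h₀ hya
    rw [← hb] at h₁ hyb
    have e : j + (d + 1) = j + 1 + d := by lia
    rw [e] at P ⊢
    have hs : s j = 0 ∨ s j = 1 := by
      generalize s j = i
      revert i
      decide
    rcases hs with hs | hs
    · obtain ⟨p, hp, hyp, hsup⟩ := ih (j := j + 1) (a := 2 + j) (b := b)
        (by rw [← hs, front_succ_self]) (by rw [front_succ_of_ne s (by simp [hs]), hb]) P (by lia)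
      refine ⟨.cons hya.symm p, hp.cons ?_, by simp [hyp], ?_⟩
      · intro h
        obtain ⟨q, hq, he, hq'⟩ := hsup _ h
        have := P.injOn (Set.mem_Iio.2 (by lia)) (Set.mem_Iio.2 (by lia)) he
        lia
      · intro v hv
        rw [Walk.support_cons, List.mem_cons] at hv
        rcases hv with rfl | hv
        · exact ⟨a, by lia, rfl, by simp⟩
        · obtain ⟨q, hq, he, hq'⟩ := hsup _ hv
          exact ⟨q, hq, he, by lia⟩
    · obtain ⟨p, hp, hyp, hsup⟩ := ih (j := j + 1) (a := a) (b := 2 + j)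
        (by rw [front_succ_of_ne s (by simp [hs]), ha]) (by rw [← hs, front_succ_self]) P (by lia)
      refine ⟨p.concat hyb, hp.concat ?_ hyb, by simp [Walk.support_concat, hyp], ?_⟩
      · intro h
        obtain ⟨q, hq, he, hq'⟩ := hsup _ h
        have := P.injOn (Set.mem_Iio.2 (by lia)) (Set.mem_Iio.2 (by lia)) he
        lia
      · intro v hv
        rw [Walk.support_concat, List.mem_append, List.mem_singleton] at hv
        rcases hv with hv | rfl
        · obtain ⟨q, hq, he, hq'⟩ := hsup _ hv
          exact ⟨q, hq, he, by lia⟩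
        · exact ⟨b, by lia, rfl, by simp⟩

theorem exists_path_start (P : IsKPathEmbedding G s (2 + m + 1) f) (hm : 1 ≤ m) (hs : s 0 = 0) :
    G.Adj (f 2) (f 1) ∧ G.Adj (f 0) (f 2) ∧ G.Adj (f 0) (f 1) ∧
    ∃ p : G.Walk (f 2) (f 1), p.IsPath ∧ f (2 + m) ∈ p.support ∧ f 0 ∉ p.support := by
  obtain ⟨p, hp, hy, hsup⟩ := P.exists_path hm (a := 2) (b := 1)
    (by rw [← hs]; exact (front_succ_self s 0).symm)
    (by rw [front_succ_of_ne s (by simp [hs])]; rfl)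
  refine ⟨P.adj_front (Nat.zero_le m) 1, (P.adj_front (Nat.zero_le m) 0).symm,
    P.front_adj_front (Nat.zero_le m) 0 1 (by decide), p, hp, hy, fun h => ?_⟩
  obtain ⟨q, hq, he, hq'⟩ := hsup _ h
  have := P.injOn (Set.mem_Iio.2 (by lia)) (Set.mem_Iio.2 (by lia)) he
  lia

/-- In a `K₄`-minor-free graph, the first and the last vertex of an embedded `2`-path determine
the edge that the first vertex is attached to. -/
theorem start_unique (hG : ¬ G.HasMinor (⊤ : SimpleGraph (Fin 4)))
    (P : IsKPathEmbedding G s (2 + m + 1) f) (P' : IsKPathEmbedding G s' (2 + m + 1) f')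
    (hm : 1 ≤ m) (hs : s 0 = 0) (hs' : s' 0 = 0) (hx : f 0 = f' 0)
    (hy : f (2 + m) = f' (2 + m)) :
    (f 1 = f' 1 ∧ f 2 = f' 2) ∨ (f 1 = f' 2 ∧ f 2 = f' 1) := by
  obtain ⟨h₂₁, h₀₂, h₀₁, p, hp, hyp, hxp⟩ := P.exists_path_start hm hs
  obtain ⟨h₂₁', h₀₂', h₀₁', p', hp', hyp', hxp'⟩ := P'.exists_path_start hm hs'
  rw [← hx] at h₀₂' h₀₁' hxp'
  rw [← hy] at hyp'
  have hy₁ : f' 1 ≠ f (2 + m) := hy ▸ P'.ne (by lia) le_rfl (by lia)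
  have hy₂ : f' 2 ≠ f (2 + m) := hy ▸ P'.ne (by lia) le_rfl (by lia)
  have h₂ : f 2 = f' 2 ∨ f 2 = f' 1 := by
    by_contra! h
    exact hG (hasMinor_top_four_of_two_cycles hp hp' h₂₁ h₂₁' hxp hxp' hyp hyp' hy₂ hy₁
      h₀₂ h₀₁ h₀₂' h₀₁' h.1 h.2)
  have h₁ : f 1 = f' 2 ∨ f 1 = f' 1 := by
    by_contra! h
    exact hG (hasMinor_top_four_of_two_cycles hp.reverse hp' h₂₁.symm h₂₁' (by simpa using hxp)
      hxp' (by simpa using hyp) hyp' hy₂ hy₁ h₀₁ h₀₂ h₀₂' h₀₁' h.1 h.2)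
  have := h₂₁.ne
  grind

end IsKPathEmbedding


theorem pow_le_pow_succ_of_universal {k m N : ℕ} (hk : 0 < k) {U : SimpleGraph (Fin N)}
    (hU : ¬ U.HasMinor (⊤ : SimpleGraph (Fin (k + 2))))
    (hcont : ∀ H : SimpleGraph (Fin (k + m + 1)),
      ¬ H.HasMinor (⊤ : SimpleGraph (Fin (k + 2))) → ContainsSub U H) :
    k ^ m ≤ N ^ (k + 1) := by
  let extend : (Fin m → Fin k) → ℕ → Fin k := fun σ j => if h : j < m then σ ⟨j, h⟩ else ⟨0, hk⟩
  have hex : ∀ σ, ∃ f, IsKPathEmbedding U (extend σ) (k + m + 1) f := fun σ =>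
    (hcont _ (kPath_not_hasMinor (extend σ) _)).exists_isKPathEmbedding (by lia)
  choose f hf using hex
  have hinj : Function.Injective fun σ => ((fun i : Fin k => f σ i, f σ (k + m)) :
      (Fin k → Fin N) × Fin N) := by
    intro σ τ h
    rw [Prod.mk.injEq] at h
    have := IsKPathEmbedding.string_unique hU (hf σ) (hf τ) (congrFun h.1) h.2
    ext j
    simpa [extend] using congrArg Fin.val (this j j.2)
  simpa [pow_succ] using Fintype.card_le_of_injective _ hinj

theorem two_pow_le_of_universal {m N : ℕ} {U : SimpleGraph (Fin N)}
    (hU : ¬ U.HasMinor (⊤ : SimpleGraph (Fin 4)))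
    (hcont : ∀ H : SimpleGraph (Fin (2 + (m + 1) + 1)),
      ¬ H.HasMinor (⊤ : SimpleGraph (Fin 4)) → ContainsSub U H) :
    2 ^ m ≤ N ^ 2 * 2 := by
  let extend : (Fin m → Fin 2) → ℕ → Fin 2 := fun σ j => if h : j - 1 < m ∧ 0 < j then
    σ ⟨j - 1, h.1⟩ else 0
  have hex : ∀ σ, ∃ f, IsKPathEmbedding U (extend σ) (2 + (m + 1) + 1) f := fun σ =>
    (hcont _ (kPath_not_hasMinor (extend σ) _)).exists_isKPathEmbedding (by lia)
  choose f hf using hex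
  have hinj : Function.Injective fun σ => ((f σ 0, f σ (2 + (m + 1)), decide (f σ 1 < f σ 2)) :
      Fin N × Fin N × Bool) := by
    intro σ τ h
    simp only [Prod.mk.injEq, decide_eq_decide] at h
    obtain ⟨hx, hy, hlt⟩ := h
    have h₁₂ : f σ 1 ≠ f σ 2 := (hf σ).ne (by lia) (by lia) (by lia)
    have hst : f σ 1 = f τ 1 := by
      rcases IsKPathEmbedding.start_unique hU (hf σ) (hf τ) (by lia) (by simp [extend])
        (by simp [extend]) hx hy with h | h
      · exact h.1
      · rw [← h.1, ← h.2] at hlt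
        rcases lt_or_gt_of_ne h₁₂ with h' | h'
        · exact absurd (hlt.1 h') h'.asymm
        · exact absurd (hlt.2 h') h'.asymm
    have := IsKPathEmbedding.string_unique hU (hf σ) (hf τ) (fun i => by
      fin_cases i
      · exact hx
      · exact hst) hy
    ext j
    simpa [extend] using congrArg Fin.val (this (j + 1) (by lia))
  simpa [pow_two, mul_assoc] using Fintype.card_le_of_injective _ hinj

theorem two_pow_le_pow_of_universal {k m N : ℕ} (hk : 2 ≤ k) (hm : 3 ≤ m)
    {U : SimpleGraph (Fin N)} (hU : ¬ U.HasMinor (⊤ : SimpleGraph (Fin (k + 2))))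
    (hcont : ∀ H : SimpleGraph (Fin (k + m + 1)),
      ¬ H.HasMinor (⊤ : SimpleGraph (Fin (k + 2))) → ContainsSub U H) :
    2 ^ (m - 3) ≤ N ^ k := by
  rcases hk.eq_or_lt with rfl | hk
  · obtain ⟨d, rfl⟩ := Nat.exists_eq_add_of_le' hm
    have h := two_pow_le_of_universal (m := d + 2) hU hcont
    rw [Nat.add_sub_cancel]
    rw [pow_add] at h
    lia
  · have h := pow_le_pow_succ_of_universal (by lia) hU hcont
    refine (Nat.pow_le_pow_right (by lia) (Nat.sub_le m 3)).trans ?_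
    rw [← Nat.pow_le_pow_iff_left (n := k + 1) (by lia)]
    have hkk : 2 ^ (k + 1) ≤ k ^ k := by
      obtain ⟨d, rfl⟩ := Nat.exists_eq_add_of_le' hk
      calc 2 ^ (d + 3 + 1) = 2 ^ d * 16 := by ring
        _ ≤ 3 ^ d * 27 := Nat.mul_le_mul (Nat.pow_le_pow_left (by lia) d) (by lia)
        _ = 3 ^ (d + 3) := by ring
        _ ≤ (d + 3) ^ (d + 3) := Nat.pow_le_pow_left (by lia) _
    calc (2 ^ m) ^ (k + 1) = (2 ^ (k + 1)) ^ m := by rw [← pow_mul, ← pow_mul, mul_comm]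
      _ ≤ (k ^ k) ^ m := Nat.pow_le_pow_left hkk m
      _ = (k ^ m) ^ k := by rw [← pow_mul, ← pow_mul, mul_comm]
      _ ≤ (N ^ (k + 1)) ^ k := Nat.pow_le_pow_left h k
      _ = (N ^ k) ^ (k + 1) := by rw [← pow_mul, ← pow_mul, mul_comm]

end SimpleGraph

/-- For all `t ≥ 4` and `n > t − 2`, if a `K_t`-minor-free graph `U`
contains every `n`-vertex `K_t`-minor-free graph as a subgraph, then `U` has at least
`2^((n − t − 2)/(t − 2))` vertices. -/
theorem statement19 (t n : ℕ) (ht : 4 ≤ t) (hn : t - 2 < n)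
    (N : ℕ) (U : SimpleGraph (Fin N))
    (hU : ¬ U.HasMinor (⊤ : SimpleGraph (Fin t)))
    (hcont : ∀ H : SimpleGraph (Fin n),
      ¬ H.HasMinor (⊤ : SimpleGraph (Fin t)) → ContainsSub U H) :
    (2 : ℝ) ^ (((n : ℝ) - t - 2) / ((t : ℝ) - 2)) ≤ (N : ℝ) := by
  obtain ⟨k, rfl⟩ := Nat.exists_eq_add_of_le' (show 2 ≤ t by lia)
  obtain ⟨m, rfl⟩ : ∃ m, n = k + m + 1 := ⟨n - k - 1, by lia⟩
  have hk : 2 ≤ k := by lia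
  have hk₀ : (0 : ℝ) < k := by exact_mod_cast (by lia : 0 < k)
  have hexp : (((k + m + 1 : ℕ) : ℝ) - (k + 2 : ℕ) - 2) / (((k + 2 : ℕ) : ℝ) - 2) =
      ((m : ℝ) - 3) / k := by
    push_cast
    congr 1 <;> ring
  rw [hexp]
  rcases le_or_gt 3 m with hm | hm
  · have h := SimpleGraph.two_pow_le_pow_of_universal hk hm hU hcont
    rw [← Real.rpow_le_rpow_iff (by positivity) (by positivity) hk₀,
      ← Real.rpow_mul (by norm_num), div_mul_cancel₀ _ hk₀.ne', Real.rpow_natCast,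
      show (m : ℝ) - 3 = ((m - 3 : ℕ) : ℝ) by push_cast [hm]; rfl, Real.rpow_natCast]
    exact_mod_cast h
  · have hN : 0 < N := by
      obtain ⟨f, -⟩ := hcont _ (SimpleGraph.kPath_not_hasMinor (fun _ => ⟨0, by lia⟩) _)
      exact (f 0).pos
    have hm' : (m : ℝ) ≤ 3 := by exact_mod_cast hm.le
    calc (2 : ℝ) ^ (((m : ℝ) - 3) / k) ≤ 1 :=
          Real.rpow_le_one_of_one_le_of_nonpos (by norm_num)
            (div_nonpos_of_nonpos_of_nonneg (by linarith) hk₀.le)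
      _ ≤ N := by exact_mod_cast hN
end
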